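/- Let t ↦ μ_t be a weakly continuous curve of probability measures on a bounded domain M ⊆ ℝⁿ, and suppose the set {t : μ_t is absolutely continuous with respect to Lebesgue measure} has positive Lebesgue measure. Then the minimizer of μ ↦ ∫₀¹ W₂²(μ, μ_t) dt over P₂(ℝⁿ) is unique. -/

import Mathlib

open MeasureTheory Set

noncomputable section

/-- `ℝⁿ` with the Euclidean norm. -/
abbrev En (n : ℕ) := EuclideanSpace ℝ (Fin n)

/-- `γ` is a coupling of `μ` and `ν`. -/
def IsCoupling {n : ℕ} (γ : Measure (En n × En n)) (μ ν : Measure (En n)) : Prop :=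
  γ.map Prod.fst = μ ∧ γ.map Prod.snd = ν

/-- The squared quadratic Wasserstein distance `W₂²(μ,ν)`. -/
def W2sq {n : ℕ} (μ ν : Measure (En n)) : ℝ :=
  sInf { c | ∃ γ : Measure (En n × En n), IsCoupling γ μ ν ∧ c = ∫ p, ‖p.1 - p.2‖ ^ 2 ∂γ }

/-- `μ` has finite second moment. -/
def FinSecMom {n : ℕ} (μ : Measure (En n)) : Prop := Integrable (fun x => ‖x‖ ^ 2) μ

/-- The curve `t ↦ μ t` is weakly continuous on `s`. -/
def WeakContOn {n : ℕ} (μ : ℝ → Measure (En n)) (s : Set ℝ) : Prop :=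
  ∀ f : BoundedContinuousFunction (En n) ℝ, ContinuousOn (fun t => ∫ x, f x ∂(μ t)) s

/-- `μb` is a barycenter of the curve `t ↦ μ t`, `t ∈ [0,1]`: it minimizes
`ν ↦ ∫₀¹ W₂²(μ_t, ν) dt` over probability measures with finite second moment. -/
def IsBarycenter {n : ℕ} (μ : ℝ → Measure (En n)) (μb : Measure (En n)) : Prop :=
  IsProbabilityMeasure μb ∧ FinSecMom μb ∧
    ∀ ν : Measure (En n), IsProbabilityMeasure ν → FinSecMom ν →
      ∫ t in Icc (0:ℝ) 1, W2sq (μ t) μb ≤ ∫ t in Icc (0:ℝ) 1, W2sq (μ t) ν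

open scoped NNReal ENNReal Topology
open Filter

section Rockafellar

variable {E : Type*} [NormedAddCommGroup E] [InnerProductSpace ℝ E]

/-- The sum of increments of the relation `p 0, p 1, …` along a chain of length `m` ending at `z`. -/
def chainSum (p : ℕ → E × E) (m : ℕ) (z : E) : ℝ :=
  ∑ i ∈ Finset.range m, inner ℝ ((p (i + 1)).1 - (p i).1) (p i).2 +
    inner ℝ (z - (p m).1) (p m).2

/-- Cyclical monotonicity of a relation on an inner product space. -/
def IsCyclicallyMonotone (Γ : Set (E × E)) : Prop :=
  ∀ (p : ℕ → E × E) (m : ℕ), (∀ i, p i ∈ Γ) → chainSum p m (p 0).1 ≤ 0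

lemma IsCyclicallyMonotone.mono {Γ Γ' : Set (E × E)} (h : IsCyclicallyMonotone Γ) (h' : Γ' ⊆ Γ) :
    IsCyclicallyMonotone Γ' :=
  fun p m hp => h p m fun i => h' (hp i)

lemma chainSum_le_chainSum_add {p : ℕ → E × E} {K : ℝ≥0} (hp : ∀ i, ‖(p i).2‖ ≤ K) (m : ℕ)
    (z w : E) : chainSum p m z ≤ chainSum p m w + K * ‖z - w‖ := by
  have h1 : inner ℝ (z - (p m).1) (p m).2
      = inner ℝ (w - (p m).1) (p m).2 + inner ℝ (z - w) (p m).2 := by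
    rw [← inner_add_left]; congr 1; abel
  have h2 : inner ℝ (z - w) (p m).2 ≤ K * ‖z - w‖ := by
    refine (real_inner_le_norm _ _).trans ?_
    rw [mul_comm]
    gcongr
    exact hp m
  unfold chainSum
  linarith

lemma chainSum_update (p : ℕ → E × E) (m : ℕ) (q : E × E) (z : E) :
    chainSum (Function.update p (m + 1) q) (m + 1) z
      = chainSum p m q.1 + inner ℝ (z - q.1) q.2 := by
  unfold chainSum
  rw [Finset.sum_range_succ]
  have h : ∀ i ≤ m, Function.update p (m + 1) q i = p i := fun i hi =>
    Function.update_of_ne (by omega) _ _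
  simp only [Function.update_self, h m le_rfl]
  congr 2
  refine Finset.sum_congr rfl fun i hi => ?_
  rw [Finset.mem_range] at hi
  rw [h i hi.le, h (i + 1) hi]

/-- **Rockafellar's theorem** for a relation with bounded values: a cyclically monotone relation is
contained in the subdifferential of a Lipschitz function. -/
lemma IsCyclicallyMonotone.exists_potential {Γ : Set (E × E)} (h : IsCyclicallyMonotone Γ)
    {K : ℝ≥0} (hK : ∀ q ∈ Γ, ‖q.2‖ ≤ K) :
    ∃ φ : E → ℝ, LipschitzWith K φ ∧ ∀ q ∈ Γ, ∀ z, φ q.1 + inner ℝ (z - q.1) q.2 ≤ φ z := by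
  rcases Γ.eq_empty_or_nonempty with rfl | ⟨q₀, hq₀⟩
  · exact ⟨fun _ => 0, LipschitzWith.const' 0, by simp⟩
  let C := {c : (ℕ → E × E) × ℕ // (∀ i, c.1 i ∈ Γ) ∧ c.1 0 = q₀}
  let φ : E → ℝ := fun z => ⨆ c : C, chainSum c.1.1 c.1.2 z
  have hne : Nonempty C := ⟨⟨(fun _ => q₀, 0), fun _ => hq₀, rfl⟩⟩
  have hbdd : ∀ z, BddAbove (range fun c : C => chainSum c.1.1 c.1.2 z) := by
    intro z
    refine ⟨K * ‖z - q₀.1‖, ?_⟩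
    rintro _ ⟨⟨⟨p, m⟩, hp, h0⟩, rfl⟩
    have h1 := chainSum_le_chainSum_add (fun i => hK _ (hp i)) m z q₀.1
    have h2 := h p m hp
    simp only at h0 h1 h2 ⊢
    rw [h0] at h2
    linarith
  refine ⟨φ, LipschitzWith.of_le_add_mul K fun z w => ?_, fun q hq z => ?_⟩
  · refine ciSup_le fun c => ?_
    rw [dist_eq_norm]
    refine (chainSum_le_chainSum_add (fun i => hK _ (c.2.1 i)) c.1.2 z w).trans ?_
    gcongr
    exact le_ciSup (hbdd w) c
  · rw [← le_sub_iff_add_le]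
    refine ciSup_le fun c => ?_
    rw [le_sub_iff_add_le, ← chainSum_update]
    refine le_ciSup (hbdd z) (⟨(Function.update c.1.1 (c.1.2 + 1) q, c.1.2 + 1), ?_, ?_⟩ : C)
    · intro i
      rcases eq_or_ne i (c.1.2 + 1) with rfl | hi
      · simpa using hq
      · simpa [Function.update_of_ne hi] using c.2.1 i
    · simpa [Function.update_of_ne (Nat.succ_ne_zero c.1.2).symm] using c.2.2

/-- A function has at most one subgradient at a point of differentiability. -/
lemma eq_of_subgradient {φ : E → ℝ} {x y₁ y₂ : E} (hφ : DifferentiableAt ℝ φ x)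
    (h₁ : ∀ z, φ x + inner ℝ (z - x) y₁ ≤ φ z) (h₂ : ∀ z, φ x + inner ℝ (z - x) y₂ ≤ φ z) :
    y₁ = y₂ := by
  have key : ∀ y, (∀ z, φ x + inner ℝ (z - x) y ≤ φ z) → fderiv ℝ φ x = innerSL ℝ y := by
    intro y hy
    have hd : HasFDerivAt (fun z => φ z - innerSL ℝ y (z - x)) (fderiv ℝ φ x - innerSL ℝ y) x := by
      refine hφ.hasFDerivAt.sub ?_
      exact (innerSL ℝ y).hasFDerivAt.comp x ((hasFDerivAt_id x).sub_const x)
    have hmin : IsLocalMin (fun z => φ z - innerSL ℝ y (z - x)) x := by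
      refine Eventually.of_forall fun z => ?_
      have := hy z
      rw [real_inner_comm] at this
      simp only [innerSL_apply_apply, sub_self, inner_zero_right, sub_zero]
      linarith
    exact sub_eq_zero.1 (hmin.hasFDerivAt_eq_zero hd)
  have h := (key y₁ h₁).symm.trans (key y₂ h₂)
  refine ext_inner_right ℝ fun v => ?_
  simpa using congrArg (fun L : E →L[ℝ] ℝ => L v) h

/-- A cyclically monotone relation is single-valued almost everywhere. -/
lemma IsCyclicallyMonotone.ae_subsingleton [FiniteDimensional ℝ E] [MeasurableSpace E]
    [BorelSpace E] (ν : Measure E) [ν.IsAddHaarMeasure] {Γ : Set (E × E)}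
    (h : IsCyclicallyMonotone Γ) :
    ∀ᵐ x ∂ν, ∀ y₁ y₂, (x, y₁) ∈ Γ → (x, y₂) ∈ Γ → y₁ = y₂ := by
  have H : ∀ k : ℕ, ∀ᵐ x ∂ν, ∀ y₁ y₂, ‖y₁‖ ≤ k → ‖y₂‖ ≤ k → (x, y₁) ∈ Γ → (x, y₂) ∈ Γ →
      y₁ = y₂ := by
    intro k
    obtain ⟨φ, hφ, hsub⟩ := (h.mono (inter_subset_left : Γ ∩ {q | ‖q.2‖ ≤ k} ⊆ Γ)).exists_potential
      (K := k) (fun q hq => by simpa using hq.2)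
    filter_upwards [hφ.ae_differentiableAt (μ := ν)] with x hx y₁ y₂ hk₁ hk₂ hy₁ hy₂
    exact eq_of_subgradient hx (hsub (x, y₁) ⟨hy₁, hk₁⟩) (hsub (x, y₂) ⟨hy₂, hk₂⟩)
  filter_upwards [ae_all_iff.2 H] with x hx y₁ y₂ hy₁ hy₂
  obtain ⟨k, hk⟩ := exists_nat_ge (max ‖y₁‖ ‖y₂‖)
  exact hx k y₁ y₂ ((le_max_left _ _).trans hk) ((le_max_right _ _).trans hk) hy₁ hy₂

/-- A relation on which pairing is optimal for the quadratic cost among all permutations is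
cyclically monotone. -/
lemma isCyclicallyMonotone_of_sum_le {Γ : Set (E × E)}
    (h : ∀ (N : ℕ) (p : Fin N → E × E) (σ : Equiv.Perm (Fin N)), (∀ i, p i ∈ Γ) →
      ∑ i, ‖(p i).1 - (p i).2‖ ^ 2 ≤ ∑ i, ‖(p (σ i)).1 - (p i).2‖ ^ 2) :
    IsCyclicallyMonotone Γ := by
  intro p m hp
  have h1 := h (m + 1) (fun i => p i) (finRotate (m + 1)) fun i => hp i
  simp only [norm_sub_sq_real, Finset.sum_add_distrib, Finset.sum_sub_distrib] at h1
  rw [Equiv.sum_comp (finRotate (m + 1)) fun i : Fin (m + 1) => ‖(p i).1‖ ^ 2,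
    ← Finset.mul_sum, ← Finset.mul_sum] at h1
  have h2 : ∑ i : Fin (m + 1), inner ℝ (p (finRotate (m + 1) i)).1 (p i).2
      ≤ ∑ i : Fin (m + 1), inner ℝ (p i).1 (p i).2 := by linarith
  have h3 : chainSum p m (p 0).1 = ∑ i : Fin (m + 1),
      inner ℝ ((p (finRotate (m + 1) i)).1 - (p i).1) (p i).2 := by
    rw [Fin.sum_univ_castSucc, chainSum, Finset.sum_range]
    congr 1
    · refine Finset.sum_congr rfl fun i _ => ?_
      rw [finRotate_of_lt (by simp)]
      simp
    · simp
  rw [h3]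
  simp only [inner_sub_left, Finset.sum_sub_distrib]
  linarith

end Rockafellar

section Support

variable {E : Type*} [NormedAddCommGroup E] [MeasurableSpace E]

/-- The quadratic transport cost of a plan, as an extended nonnegative real. -/
def transportCost (γ : Measure (E × E)) : ℝ≥0∞ :=
  ∫⁻ p, ENNReal.ofReal (‖p.1 - p.2‖ ^ 2) ∂γ

lemma transportCost_add (γ γ' : Measure (E × E)) :
    transportCost (γ + γ') = transportCost γ + transportCost γ' :=
  lintegral_add_measure _ _ _

variable [BorelSpace E] [SecondCountableTopology E]

/-- The support of an optimal transport plan is optimally paired. -/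
lemma sum_sq_norm_sub_le_of_mem_support {γ : Measure (E × E)} [IsProbabilityMeasure γ]
    (hfin : transportCost γ ≠ ∞)
    (hopt : ∀ γ' : Measure (E × E), γ'.map Prod.fst = γ.map Prod.fst →
      γ'.map Prod.snd = γ.map Prod.snd → transportCost γ ≤ transportCost γ')
    {ι : Type*} [Fintype ι] (p : ι → E × E) (σ : Equiv.Perm ι) (hp : ∀ i, p i ∈ γ.support) :
    ∑ i, ‖(p i).1 - (p i).2‖ ^ 2 ≤ ∑ i, ‖(p (σ i)).1 - (p i).2‖ ^ 2 := by
  classical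
  by_contra! hlt
  have hopen : IsOpen {q : ι → E × E |
      ∑ i, ‖(q (σ i)).1 - (q i).2‖ ^ 2 < ∑ i, ‖(q i).1 - (q i).2‖ ^ 2} :=
    isOpen_lt (by fun_prop) (by fun_prop)
  obtain ⟨U, hU, hUsub⟩ := isOpen_pi_iff'.1 hopen p hlt
  have hι : Nonempty ι := by
    by_contra h
    rw [not_nonempty_iff] at h
    simp at hlt
  have hpos : ∀ i, γ (U i) ≠ 0 := fun i =>
    ((Measure.mem_support_iff_forall _).1 (hp i) _ ((hU i).1.mem_nhds (hU i).2)).ne'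
  let κ : ι → Measure (E × E) := fun i => ProbabilityTheory.cond γ (U i)
  have hκ : ∀ i, IsProbabilityMeasure (κ i) := fun i =>
    ProbabilityTheory.cond_isProbabilityMeasure (hpos i)
  let P : Measure (ι → E × E) := Measure.pi κ
  have hPκ : ∀ i, P.map (fun q => q i) = κ i := fun i =>
    (measurePreserving_eval κ i).map_eq
  have hPU : ∀ᵐ q ∂P, ∀ i, q i ∈ U i := by
    refine ae_all_iff.2 fun i => ?_
    have : ∀ᵐ x ∂(P.map fun q => q i), x ∈ U i := by
      rw [hPκ]
      exact ProbabilityTheory.ae_cond_mem (hU i).1.measurableSet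
    exact ae_of_ae_map (measurable_pi_apply i).aemeasurable this
  let ε : ℝ≥0∞ := (∑ i, (γ (U i))⁻¹)⁻¹
  have hsum_top : ∑ i, (γ (U i))⁻¹ ≠ ∞ := by
    simpa [ENNReal.sum_eq_top] using hpos
  have hsum_zero : ∑ i, (γ (U i))⁻¹ ≠ 0 := by
    obtain ⟨i⟩ := hι
    simp only [ne_eq, Finset.sum_eq_zero_iff, Finset.mem_univ, true_implies, not_forall]
    exact ⟨i, by simp⟩
  have hε0 : ε ≠ 0 := ENNReal.inv_ne_zero.2 hsum_top
  have hεtop : ε ≠ ∞ := ENNReal.inv_ne_top.2 hsum_zero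
  let τ : Measure (E × E) := ε • ∑ i, P.map (fun q => q i)
  have hτ : τ ≤ γ := by
    have h1 : ∑ i, P.map (fun q => q i) ≤ ∑ i, (γ (U i))⁻¹ • γ := by
      refine Finset.sum_le_sum fun i _ => ?_
      rw [hPκ]
      refine Measure.le_iff.2 fun s _ => ?_
      simp only [κ, ProbabilityTheory.cond, Measure.smul_apply, smul_eq_mul]
      gcongr
      exact Measure.restrict_le_self
    refine Measure.le_iff.2 fun s hs => ?_
    have h2 := Measure.le_iff.1 h1 s hs
    rw [← Finset.sum_smul] at h2
    calc τ s ≤ ε * (((∑ i, (γ (U i))⁻¹) • γ) s) := by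
          simp only [τ, Measure.smul_apply, smul_eq_mul] at h2 ⊢
          gcongr
      _ = γ s := by
          rw [Measure.smul_apply, smul_eq_mul, ← mul_assoc,
            ENNReal.inv_mul_cancel hsum_zero hsum_top, one_mul]
  have hτfin : IsFiniteMeasure τ := isFiniteMeasure_of_le γ hτ
  let ρ : Measure (E × E) := γ - τ
  have hρ : ρ + τ = γ := Measure.sub_add_cancel_of_le hτ
  let g : ι → (ι → E × E) → E × E := fun i q => ((q (σ i)).1, (q i).2)
  have hg : ∀ i, Measurable (g i) := fun i => by fun_prop
  let τ' : Measure (E × E) := ε • ∑ i, P.map (g i)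
  have hsum_map : ∀ {F : Type _} [MeasurableSpace F] (f : ι → (ι → E × E) → E × E)
      (_ : ∀ i, Measurable (f i)) (k : E × E → F) (_ : Measurable k),
      (ε • ∑ i, P.map (f i)).map k = ε • ∑ i, P.map (k ∘ f i) := by
    intro F _ f hf k hk
    rw [Measure.map_smul]
    congr 1
    rw [← Measure.mapₗ_apply_of_measurable hk, map_sum]
    refine Finset.sum_congr rfl fun i _ => ?_
    rw [Measure.mapₗ_apply_of_measurable hk, Measure.map_map hk (hf i)]
  have hfst : (ρ + τ').map Prod.fst = γ.map Prod.fst := by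
    rw [← hρ, Measure.map_add _ _ measurable_fst, Measure.map_add _ _ measurable_fst]
    congr 1
    rw [hsum_map _ hg _ measurable_fst,
      hsum_map _ (fun i => measurable_pi_apply i) _ measurable_fst]
    congr 1
    exact Equiv.sum_comp σ fun i => P.map (Prod.fst ∘ fun q => q i)
  have hsnd : (ρ + τ').map Prod.snd = γ.map Prod.snd := by
    rw [← hρ, Measure.map_add _ _ measurable_snd, Measure.map_add _ _ measurable_snd]
    congr 1
    rw [hsum_map _ hg _ measurable_snd,
      hsum_map _ (fun i => measurable_pi_apply i) _ measurable_snd]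
    rfl
  have hcost := hopt _ hfst hsnd
  have hc : Measurable fun p : E × E => ENNReal.ofReal (‖p.1 - p.2‖ ^ 2) := by fun_prop
  have hcost_sum : ∀ (f : ι → (ι → E × E) → E × E) (_ : ∀ i, Measurable (f i)),
      transportCost (ε • ∑ i, P.map (f i))
        = ε * ∫⁻ q, ENNReal.ofReal (∑ i, ‖(f i q).1 - (f i q).2‖ ^ 2) ∂P := by
    intro f hf
    rw [transportCost, lintegral_smul_measure, smul_eq_mul, lintegral_finsetSum_measure]
    congr 1
    simp_rw [ENNReal.ofReal_sum_of_nonneg (fun _ _ => sq_nonneg _)]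
    rw [lintegral_finsetSum _ fun i _ => by have := hf i; fun_prop]
    exact Finset.sum_congr rfl fun i _ => lintegral_map hc (hf i)
  have hcτ := hcost_sum _ fun i => measurable_pi_apply i
  have hcτ' := hcost_sum _ hg
  have hγ : transportCost γ = transportCost ρ + transportCost τ := by
    rw [← transportCost_add, hρ]
  rw [hγ, transportCost_add] at hcost
  rw [hγ] at hfin
  have hcost' := (ENNReal.add_le_add_iff_left (fun h => hfin (by simp [h]))).1 hcost
  have hτtop : transportCost τ ≠ ∞ := fun h => hfin (by simp [h])
  simp only [τ, τ'] at hcost' hτtop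
  rw [hcτ, hcτ', ENNReal.mul_le_mul_iff_right hε0 hεtop] at hcost'
  rw [hcτ] at hτtop
  have hItop : ∫⁻ q, ENNReal.ofReal (∑ i, ‖(q i).1 - (q i).2‖ ^ 2) ∂P ≠ ∞ :=
    fun h => hτtop (by rw [h, ENNReal.mul_top hε0])
  have hlt_ae : ∀ᵐ q ∂P, ENNReal.ofReal (∑ i, ‖(g i q).1 - (g i q).2‖ ^ 2)
      < ENNReal.ofReal (∑ i, ‖(q i).1 - (q i).2‖ ^ 2) := by
    filter_upwards [hPU] with q hq
    have : q ∈ {q : ι → E × E |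
      ∑ i, ‖(q (σ i)).1 - (q i).2‖ ^ 2 < ∑ i, ‖(q i).1 - (q i).2‖ ^ 2} :=
      hUsub fun i _ => hq i
    exact (ENNReal.ofReal_lt_ofReal_iff_of_nonneg (by positivity)).2 this
  refine absurd hcost' (not_le.2 (lintegral_strict_mono (IsProbabilityMeasure.ne_zero P)
    (by fun_prop) ?_ hlt_ae))
  exact ne_top_of_le_ne_top hItop (lintegral_mono_ae (hlt_ae.mono fun _ h => h.le))

end Support

section Graph

/-- Two plans with the same first marginal which are carried by a common closed set that is almost
everywhere a graph have the same second marginal. -/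
lemma map_snd_eq_of_ae_graph {X Y : Type*} [TopologicalSpace X] [T2Space X]
    [SigmaCompactSpace X] [MeasurableSpace X] [BorelSpace X] [TopologicalSpace Y]
    [SigmaCompactSpace Y] [MeasurableSpace Y] [BorelSpace Y] {γ₁ γ₂ : Measure (X × Y)}
    [IsFiniteMeasure γ₁] (hfst : γ₁.map Prod.fst = γ₂.map Prod.fst) {S : Set (X × Y)}
    (hS : IsClosed S) (h₁ : ∀ᵐ p ∂γ₁, p ∈ S) (h₂ : ∀ᵐ p ∂γ₂, p ∈ S)
    (hgraph : ∀ᵐ x ∂(γ₁.map Prod.fst), ∀ y₁ y₂, (x, y₁) ∈ S → (x, y₂) ∈ S → y₁ = y₂) :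
    γ₁.map Prod.snd = γ₂.map Prod.snd := by
  have hrepr : ∀ B : Set Y, IsClosed B → ∀ γ : Measure (X × Y), (∀ᵐ p ∂γ, p ∈ S) →
      (∀ᵐ x ∂(γ.map Prod.fst), ∀ y₁ y₂, (x, y₁) ∈ S → (x, y₂) ∈ S → y₁ = y₂) →
      γ.map Prod.snd B = γ.map Prod.fst (Prod.fst '' (S ∩ Prod.snd ⁻¹' B)) := by
    intro B hB γ hγS hγ
    obtain ⟨K, hK, hKeq⟩ := ((isSigmaCompact_univ (X := X × Y)).of_isClosed_subset
      (hS.inter (hB.preimage continuous_snd)) (subset_univ _)).image continuous_fst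
    have hmeas : MeasurableSet (Prod.fst '' (S ∩ Prod.snd ⁻¹' B)) := by
      rw [← hKeq]
      exact MeasurableSet.iUnion fun i => (hK i).isClosed.measurableSet
    rw [Measure.map_apply measurable_snd hB.measurableSet, Measure.map_apply measurable_fst hmeas]
    refine measure_congr ?_
    filter_upwards [hγS, ae_of_ae_map measurable_fst.aemeasurable hγ] with p hpS hp
    refine propext ⟨fun hpB => ⟨p, ⟨hpS, hpB⟩, rfl⟩, ?_⟩
    rintro ⟨q, ⟨hqS, hqB⟩, hqp⟩
    have : q.2 = p.2 := hp q.2 p.2 (by rw [← hqp]; exact hqS) hpS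
    change p.2 ∈ B
    rw [← this]
    exact hqB
  refine ext_of_generate_finite {B | IsClosed B}
    (by rw [BorelSpace.measurable_eq (α := Y), borel_eq_generateFrom_isClosed])
    isPiSystem_isClosed (fun B hB => ?_) ?_
  · rw [hrepr B hB γ₁ h₁ hgraph, hrepr B hB γ₂ h₂ (hfst ▸ hgraph), hfst]
  · rw [hrepr _ isClosed_univ γ₁ h₁ hgraph, hrepr _ isClosed_univ γ₂ h₂ (hfst ▸ hgraph), hfst]

end Graph

section Couplings

lemma lowerSemicontinuous_transportCost {E : Type*} [NormedAddCommGroup E] [MeasurableSpace E]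
    [BorelSpace E] [SecondCountableTopology E] :
    LowerSemicontinuous fun γ : ProbabilityMeasure (E × E) => transportCost (γ : Measure (E × E)) := by
  let f : ℕ → BoundedContinuousFunction (E × E) ℝ≥0 := fun k =>
    BoundedContinuousFunction.mkOfBound ⟨fun p => min (‖p.1 - p.2‖₊ ^ 2) k, by fun_prop⟩ k
      fun p q => by
        rw [NNReal.dist_eq, abs_le]
        have h1 : ((min (‖p.1 - p.2‖₊ ^ 2) k : ℝ≥0) : ℝ) ≤ k := by simp
        have h2 : ((min (‖q.1 - q.2‖₊ ^ 2) k : ℝ≥0) : ℝ) ≤ k := by simp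
        have h3 := (min (‖p.1 - p.2‖₊ ^ 2) (k : ℝ≥0)).coe_nonneg
        have h4 := (min (‖q.1 - q.2‖₊ ^ 2) (k : ℝ≥0)).coe_nonneg
        simp only [ContinuousMap.coe_mk]
        constructor <;> linarith
  have hf : ∀ γ : ProbabilityMeasure (E × E),
      transportCost (γ : Measure (E × E)) = ⨆ k, ∫⁻ p, f k p ∂(γ : Measure (E × E)) := by
    intro γ
    rw [← lintegral_iSup (fun k => (f k).continuous.measurable.coe_nnreal_ennreal)]
    · refine lintegral_congr fun p => ?_
      have : ENNReal.ofReal (‖p.1 - p.2‖ ^ 2) = ((‖p.1 - p.2‖₊ ^ 2 : ℝ≥0) : ℝ≥0∞) := by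
        rw [← ENNReal.ofReal_coe_nnreal]
        simp
      rw [this]
      refine le_antisymm ?_ (iSup_le fun k => ?_)
      · obtain ⟨k, hk⟩ := exists_nat_ge (‖p.1 - p.2‖₊ ^ 2)
        refine le_iSup_of_le k ?_
        simp [f, hk]
      · exact ENNReal.coe_le_coe.2 (min_le_left _ _)
    · intro j k hjk p
      refine ENNReal.coe_le_coe.2 (min_le_min_left _ ?_)
      exact_mod_cast hjk
  simp_rw [hf]
  exact lowerSemicontinuous_iSup fun k =>
    (ProbabilityMeasure.continuous_lintegral_boundedContinuousFunction (f k)).lowerSemicontinuous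

variable {n : ℕ}

lemma IsCoupling.isProbabilityMeasure {γ : Measure (En n × En n)} {μ ν : Measure (En n)}
    (h : IsCoupling γ μ ν) [IsProbabilityMeasure μ] : IsProbabilityMeasure γ := by
  refine ⟨?_⟩
  have := measure_univ (μ := μ)
  rwa [← h.1, Measure.map_apply measurable_fst MeasurableSet.univ, preimage_univ] at this

lemma isCoupling_prod (μ ν : Measure (En n)) [IsProbabilityMeasure μ] [IsProbabilityMeasure ν] :
    IsCoupling (μ.prod ν) μ ν := by
  constructor
  · simp
  · simp

lemma isCompact_setOf_isCoupling {T : Type*} [TopologicalSpace T] [CompactSpace T]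
    {m : T → ProbabilityMeasure (En n)} (hm : Continuous m) (ν : Measure (En n))
    [IsProbabilityMeasure ν] :
    IsCompact {x : T × ProbabilityMeasure (En n × En n) |
      IsCoupling (x.2 : Measure (En n × En n)) (m x.1 : Measure (En n)) ν} := by
  let N : ProbabilityMeasure (En n) := ⟨ν, inferInstance⟩
  have hclosed : IsClosed {x : T × ProbabilityMeasure (En n × En n) |
      IsCoupling (x.2 : Measure (En n × En n)) (m x.1 : Measure (En n)) ν} := by
    have : {x : T × ProbabilityMeasure (En n × En n) |
        IsCoupling (x.2 : Measure (En n × En n)) (m x.1 : Measure (En n)) ν}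
        = {x | x.2.map continuous_fst.measurable.aemeasurable = m x.1} ∩
          {x | x.2.map continuous_snd.measurable.aemeasurable = N} := by
      ext x
      refine and_congr ?_ ?_
      · exact ProbabilityMeasure.toMeasure_injective.eq_iff
          (a := x.2.map continuous_fst.measurable.aemeasurable)
      · exact ProbabilityMeasure.toMeasure_injective.eq_iff
          (a := x.2.map continuous_snd.measurable.aemeasurable) (b := N)
    rw [this]
    exact (isClosed_eq ((ProbabilityMeasure.continuous_map continuous_fst).comp continuous_snd)
        (hm.comp continuous_fst)).inter
      (isClosed_eq ((ProbabilityMeasure.continuous_map continuous_snd).comp continuous_snd)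
        continuous_const)
  let S : Set (ProbabilityMeasure (En n × En n)) :=
    {γ | ∃ t, IsCoupling (γ : Measure (En n × En n)) (m t : Measure (En n)) ν}
  have hS : IsCompact (closure S) := by
    refine isCompact_closure_of_isTightMeasureSet (IsTightMeasureSet.prodMk ?_ ?_)
    · have hr : IsCompact (closure (range m)) := by
        rw [(isCompact_range hm).isClosed.closure_eq]
        exact isCompact_range hm
      refine (isTightMeasureSet_of_isCompact_closure hr).subset ?_
      rintro _ ⟨_, ⟨γ, ⟨t, ht⟩, rfl⟩, rfl⟩
      exact ⟨m t, mem_range_self t, ht.1.symm⟩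
    · refine (isTightMeasureSet_singleton (μ := ν)).subset ?_
      rintro _ ⟨_, ⟨γ, ⟨t, ht⟩, rfl⟩, rfl⟩
      exact ht.2
  exact (isCompact_univ.prod hS).of_isClosed_subset hclosed
    fun x hx => ⟨mem_univ _, subset_closure ⟨x.1, hx⟩⟩

lemma IsCoupling.integrable {γ : Measure (En n × En n)} {μ ν : Measure (En n)}
    (h : IsCoupling γ μ ν) (hμ : FinSecMom μ) (hν : FinSecMom ν) :
    Integrable (fun p => 2 * ‖p.1‖ ^ 2 + 2 * ‖p.2‖ ^ 2) γ := by
  refine Integrable.add (Integrable.const_mul ?_ 2) (Integrable.const_mul ?_ 2)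
  · rw [FinSecMom, ← h.1] at hμ
    exact hμ.comp_measurable measurable_fst
  · rw [FinSecMom, ← h.2] at hν
    exact hν.comp_measurable measurable_snd

lemma sq_norm_sub_le {E : Type*} [NormedAddCommGroup E] (x y : E) :
    ‖x - y‖ ^ 2 ≤ 2 * ‖x‖ ^ 2 + 2 * ‖y‖ ^ 2 := by
  have h := norm_sub_le x y
  nlinarith [sq_nonneg (‖x‖ - ‖y‖), norm_nonneg (x - y), norm_nonneg x, norm_nonneg y]

lemma IsCoupling.ofReal_integral {γ : Measure (En n × En n)} {μ ν : Measure (En n)}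
    (h : IsCoupling γ μ ν) (hμ : FinSecMom μ) (hν : FinSecMom ν) :
    ENNReal.ofReal (∫ p, ‖p.1 - p.2‖ ^ 2 ∂γ) = transportCost γ := by
  refine ofReal_integral_eq_lintegral_ofReal ?_ (ae_of_all _ fun p => sq_nonneg _)
  refine (h.integrable hμ hν).mono' (by fun_prop) (ae_of_all _ fun p => ?_)
  rw [Real.norm_of_nonneg (sq_nonneg _)]
  exact sq_norm_sub_le _ _

lemma W2sq_nonneg (μ ν : Measure (En n)) : 0 ≤ W2sq μ ν := by
  refine Real.sInf_nonneg ?_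
  rintro _ ⟨γ, -, rfl⟩
  positivity

lemma W2sq_le {γ : Measure (En n × En n)} {μ ν : Measure (En n)} (h : IsCoupling γ μ ν) :
    W2sq μ ν ≤ ∫ p, ‖p.1 - p.2‖ ^ 2 ∂γ := by
  refine csInf_le ⟨0, ?_⟩ ⟨γ, h, rfl⟩
  rintro _ ⟨γ, -, rfl⟩
  positivity

lemma ofReal_W2sq_le {γ : Measure (En n × En n)} {μ ν : Measure (En n)} (h : IsCoupling γ μ ν)
    (hμ : FinSecMom μ) (hν : FinSecMom ν) : ENNReal.ofReal (W2sq μ ν) ≤ transportCost γ := by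
  rw [← h.ofReal_integral hμ hν]
  exact ENNReal.ofReal_le_ofReal (W2sq_le h)

lemma W2sq_le_moments {μ ν : Measure (En n)} [IsProbabilityMeasure μ] [IsProbabilityMeasure ν]
    (hμ : FinSecMom μ) (hν : FinSecMom ν) :
    W2sq μ ν ≤ 2 * ∫ x, ‖x‖ ^ 2 ∂μ + 2 * ∫ y, ‖y‖ ^ 2 ∂ν := by
  have hc := isCoupling_prod μ ν
  have hμ' : Integrable (fun p : En n × En n => ‖p.1‖ ^ 2) (μ.prod ν) := by
    rw [FinSecMom, ← hc.1] at hμ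
    exact hμ.comp_measurable measurable_fst
  have hν' : Integrable (fun p : En n × En n => ‖p.2‖ ^ 2) (μ.prod ν) := by
    rw [FinSecMom, ← hc.2] at hν
    exact hν.comp_measurable measurable_snd
  have h1 : ∫ x, ‖x‖ ^ 2 ∂μ = ∫ p, ‖p.1‖ ^ 2 ∂(μ.prod ν) := by
    conv_lhs => rw [← hc.1]
    exact integral_map measurable_fst.aemeasurable (by fun_prop)
  have h2 : ∫ x, ‖x‖ ^ 2 ∂ν = ∫ p, ‖p.2‖ ^ 2 ∂(μ.prod ν) := by
    conv_lhs => rw [← hc.2]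
    exact integral_map measurable_snd.aemeasurable (by fun_prop)
  refine (W2sq_le hc).trans ?_
  rw [h1, h2, ← integral_const_mul, ← integral_const_mul,
    ← integral_add (hμ'.const_mul 2) (hν'.const_mul 2)]
  exact integral_mono_of_nonneg (ae_of_all _ fun p => sq_nonneg _) (hc.integrable hμ hν)
    (ae_of_all _ fun p => sq_norm_sub_le _ _)

/-- Optimal transport plans exist. -/
lemma exists_isCoupling_transportCost_eq {μ ν : Measure (En n)} [IsProbabilityMeasure μ]
    [IsProbabilityMeasure ν] (hμ : FinSecMom μ) (hν : FinSecMom ν) :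
    ∃ γ, IsCoupling γ μ ν ∧ transportCost γ = ENNReal.ofReal (W2sq μ ν) := by
  have hcomp := isCompact_setOf_isCoupling (T := Unit)
    (m := fun _ => ⟨μ, inferInstance⟩) continuous_const ν
  obtain ⟨⟨_, γ⟩, hγ, hmin⟩ := LowerSemicontinuousOn.exists_isMinOn
    ⟨((), ⟨μ.prod ν, inferInstance⟩), isCoupling_prod μ ν⟩ hcomp
    ((lowerSemicontinuous_transportCost.comp continuous_snd).lowerSemicontinuousOn _)
  refine ⟨γ, hγ, le_antisymm ?_ (ofReal_W2sq_le hγ hμ hν)⟩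
  have hγ' : IsCoupling (γ : Measure (En n × En n)) μ ν := hγ
  rw [← hγ'.ofReal_integral hμ hν]
  refine ENNReal.ofReal_le_ofReal (le_csInf ⟨_, γ, hγ', rfl⟩ ?_)
  rintro _ ⟨γ', h', rfl⟩
  have := h'.isProbabilityMeasure
  have hle : transportCost (γ : Measure (En n × En n)) ≤ transportCost γ' :=
    isMinOn_iff.1 hmin ((), ⟨γ', this⟩) h'
  rwa [← hγ'.ofReal_integral hμ hν, ← h'.ofReal_integral hμ hν,
    ENNReal.ofReal_le_ofReal_iff (by positivity)] at hle

/-- The squared Wasserstein distance to a fixed measure is lower semicontinuous along weakly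
continuous families. -/
lemma lowerSemicontinuous_ofReal_W2sq {T : Type*} [TopologicalSpace T] [CompactSpace T] [T2Space T]
    {m : T → ProbabilityMeasure (En n)} (hm : Continuous m)
    (hmom : ∀ t, FinSecMom (m t : Measure (En n))) {ν : Measure (En n)} [IsProbabilityMeasure ν]
    (hν : FinSecMom ν) :
    LowerSemicontinuous fun t => ENNReal.ofReal (W2sq (m t : Measure (En n)) ν) := by
  rw [lowerSemicontinuous_iff_isClosed_preimage]
  intro y
  have hcl : IsClosed {x : T × ProbabilityMeasure (En n × En n) |
      transportCost (x.2 : Measure (En n × En n)) ≤ y} :=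
    (lowerSemicontinuous_transportCost.comp continuous_snd).isClosed_preimage y
  have hcomp := ((isCompact_setOf_isCoupling hm ν).inter_right hcl).image continuous_fst
  convert! hcomp.isClosed using 1
  ext t
  constructor
  · intro ht
    obtain ⟨γ, hγ, hγc⟩ := exists_isCoupling_transportCost_eq (hmom t) hν
    exact ⟨(t, ⟨γ, hγ.isProbabilityMeasure⟩), ⟨hγ, hγc.trans_le ht⟩, rfl⟩
  · rintro ⟨⟨t, γ⟩, ⟨hγ, hγc⟩, rfl⟩
    exact (ofReal_W2sq_le hγ (hmom t) hν).trans hγc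

lemma isCoupling_mix {γ₁ γ₂ : Measure (En n × En n)} {μ ν₁ ν₂ : Measure (En n)}
    (h₁ : IsCoupling γ₁ μ ν₁) (h₂ : IsCoupling γ₂ μ ν₂) :
    IsCoupling ((2⁻¹ : ℝ≥0∞) • γ₁ + (2⁻¹ : ℝ≥0∞) • γ₂) μ
      ((2⁻¹ : ℝ≥0∞) • ν₁ + (2⁻¹ : ℝ≥0∞) • ν₂) := by
  constructor
  · rw [Measure.map_add _ _ measurable_fst, Measure.map_smul, Measure.map_smul, h₁.1, h₂.1,
      ← add_smul, ENNReal.inv_two_add_inv_two, one_smul]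
  · rw [Measure.map_add _ _ measurable_snd, Measure.map_smul, Measure.map_smul, h₁.2, h₂.2]

lemma isProbabilityMeasure_mix {X : Type*} [MeasurableSpace X] (ν₁ ν₂ : Measure X)
    [IsProbabilityMeasure ν₁] [IsProbabilityMeasure ν₂] :
    IsProbabilityMeasure ((2⁻¹ : ℝ≥0∞) • ν₁ + (2⁻¹ : ℝ≥0∞) • ν₂) :=
  ⟨by simp [ENNReal.inv_two_add_inv_two]⟩

lemma FinSecMom.mix {ν₁ ν₂ : Measure (En n)} (h₁ : FinSecMom ν₁) (h₂ : FinSecMom ν₂) :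
    FinSecMom ((2⁻¹ : ℝ≥0∞) • ν₁ + (2⁻¹ : ℝ≥0∞) • ν₂) :=
  (h₁.smul_measure (by simp)).add_measure (h₂.smul_measure (by simp))

lemma transportCost_mix {γ₁ γ₂ : Measure (En n × En n)} {a b : ℝ} (ha : 0 ≤ a) (hb : 0 ≤ b)
    (h₁ : transportCost γ₁ = ENNReal.ofReal a) (h₂ : transportCost γ₂ = ENNReal.ofReal b) :
    transportCost ((2⁻¹ : ℝ≥0∞) • γ₁ + (2⁻¹ : ℝ≥0∞) • γ₂) = ENNReal.ofReal ((a + b) / 2) := by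
  have hs : ∀ γ : Measure (En n × En n),
      transportCost ((2⁻¹ : ℝ≥0∞) • γ) = 2⁻¹ * transportCost γ :=
    fun γ => lintegral_smul_measure _ _
  rw [transportCost_add, hs, hs, h₁, h₂, ← mul_add, ← ENNReal.ofReal_add ha hb, div_eq_mul_inv,
    ENNReal.ofReal_mul (add_nonneg ha hb), mul_comm, ENNReal.ofReal_inv_of_pos two_pos]
  simp

/-- The squared Wasserstein distance is convex under mixtures. -/
lemma W2sq_mix_le {μ ν₁ ν₂ : Measure (En n)} [IsProbabilityMeasure μ] [IsProbabilityMeasure ν₁]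
    [IsProbabilityMeasure ν₂] (hμ : FinSecMom μ) (h₁ : FinSecMom ν₁) (h₂ : FinSecMom ν₂) :
    W2sq μ ((2⁻¹ : ℝ≥0∞) • ν₁ + (2⁻¹ : ℝ≥0∞) • ν₂) ≤ (W2sq μ ν₁ + W2sq μ ν₂) / 2 := by
  obtain ⟨γ₁, hγ₁, hc₁⟩ := exists_isCoupling_transportCost_eq hμ h₁
  obtain ⟨γ₂, hγ₂, hc₂⟩ := exists_isCoupling_transportCost_eq hμ h₂
  have h := ofReal_W2sq_le (isCoupling_mix hγ₁ hγ₂) hμ (h₁.mix h₂)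
  rw [transportCost_mix (W2sq_nonneg _ _) (W2sq_nonneg _ _) hc₁ hc₂] at h
  exact (ENNReal.ofReal_le_ofReal_iff
    (by linarith [W2sq_nonneg μ ν₁, W2sq_nonneg μ ν₂])).1 h

/-- The squared Wasserstein distance to an absolutely continuous measure is strictly convex under
mixtures. -/
lemma eq_of_W2sq_mix_eq {μ ν₁ ν₂ : Measure (En n)} [IsProbabilityMeasure μ]
    [IsProbabilityMeasure ν₁] [IsProbabilityMeasure ν₂] (hμ : FinSecMom μ) (h₁ : FinSecMom ν₁)
    (h₂ : FinSecMom ν₂) (hac : μ ≪ volume)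
    (heq : W2sq μ ((2⁻¹ : ℝ≥0∞) • ν₁ + (2⁻¹ : ℝ≥0∞) • ν₂) = (W2sq μ ν₁ + W2sq μ ν₂) / 2) :
    ν₁ = ν₂ := by
  obtain ⟨γ₁, hγ₁, hc₁⟩ := exists_isCoupling_transportCost_eq hμ h₁
  obtain ⟨γ₂, hγ₂, hc₂⟩ := exists_isCoupling_transportCost_eq hμ h₂
  have hc := transportCost_mix (W2sq_nonneg _ _) (W2sq_nonneg _ _) hc₁ hc₂
  have hγ := isCoupling_mix hγ₁ hγ₂
  rw [← heq] at hc
  set γ := (2⁻¹ : ℝ≥0∞) • γ₁ + (2⁻¹ : ℝ≥0∞) • γ₂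
  have := hγ.isProbabilityMeasure
  have := hγ₁.isProbabilityMeasure
  have hcyc : IsCyclicallyMonotone γ.support := by
    refine isCyclicallyMonotone_of_sum_le fun N p σ hp =>
      sum_sq_norm_sub_le_of_mem_support (by simp [hc]) (fun γ' hf hs => ?_) p σ hp
    rw [hc]
    exact ofReal_W2sq_le ⟨hf.trans hγ.1, hs.trans hγ.2⟩ hμ (h₁.mix h₂)
  have hsupp : ∀ᵐ p ∂γ, p ∈ γ.support := Measure.support_mem_ae
  have hsupp' := ae_add_measure_iff.1 hsupp
  have hhalf : (2⁻¹ : ℝ≥0∞) ≠ 0 := by simp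
  rw [← hγ₁.2, ← hγ₂.2]
  refine map_snd_eq_of_ae_graph (hγ₁.1.trans hγ₂.1.symm) Measure.isClosed_support
    ((Measure.ae_ennreal_smul_measure_iff hhalf).1 hsupp'.1)
    ((Measure.ae_ennreal_smul_measure_iff hhalf).1 hsupp'.2)
    ?_
  rw [hγ₁.1]
  exact hac.ae_le (hcyc.ae_subsingleton volume)

end Couplings

/-- The squared Wasserstein distance to a fixed measure is integrable along a weakly continuous
curve of measures supported in a bounded set. -/
lemma integrableOn_W2sq {n : ℕ} {μ : ℝ → Measure (En n)}
    (hprob : ∀ t ∈ Icc (0 : ℝ) 1, IsProbabilityMeasure (μ t)) (hcont : WeakContOn μ (Icc 0 1))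
    {R : ℝ} (hR : ∀ t ∈ Icc (0 : ℝ) 1, ∀ᵐ x ∂(μ t), ‖x‖ ≤ R)
    (hmom : ∀ t ∈ Icc (0 : ℝ) 1, FinSecMom (μ t)) {ν : Measure (En n)} [IsProbabilityMeasure ν]
    (hν : FinSecMom ν) : IntegrableOn (fun t => W2sq (μ t) ν) (Icc 0 1) := by
  let m : Icc (0 : ℝ) 1 → ProbabilityMeasure (En n) := fun t => ⟨μ t, hprob t t.2⟩
  have hm : Continuous m := by
    rw [ProbabilityMeasure.continuous_iff_forall_continuous_integral]
    exact fun f => (hcont f).domRestrict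
  have hmeas : Measurable fun t : Icc (0 : ℝ) 1 => W2sq (μ t) ν := by
    have h := (lowerSemicontinuous_ofReal_W2sq hm (fun t => hmom t t.2) hν).measurable
    convert! h.ennreal_toReal using 2 with t
    exact (ENNReal.toReal_ofReal (W2sq_nonneg _ _)).symm
  refine IntegrableOn.of_bound (C := 2 * R ^ 2 + 2 * ∫ y, ‖y‖ ^ 2 ∂ν) (by simp) ?_ ?_
  · exact ((aemeasurable_restrict_iff_comap_subtype measurableSet_Icc).2
      hmeas.aemeasurable).aestronglyMeasurable
  · refine (ae_restrict_iff' measurableSet_Icc).2 (ae_of_all _ fun t ht => ?_)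
    have := hprob t ht
    rw [Real.norm_of_nonneg (W2sq_nonneg _ _)]
    refine (W2sq_le_moments (hmom t ht) hν).trans ?_
    have : ∫ x, ‖x‖ ^ 2 ∂(μ t) ≤ ∫ _, R ^ 2 ∂(μ t) :=
      integral_mono_ae (hmom t ht) (integrable_const _)
        ((hR t ht).mono fun x hx => pow_le_pow_left₀ (norm_nonneg x) hx 2)
    simp only [integral_const, probReal_univ, one_smul] at this
    linarith

/-- under Assumption A (the set of times at which `μ_t` is absolutely continuous
has positive Lebesgue measure), the barycenter of the curve is unique. -/
theorem stmt5 {n : ℕ} (M : Set (En n)) (hM : Bornology.IsBounded M)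
    (μ : ℝ → Measure (En n)) (hprob : ∀ t ∈ Icc (0:ℝ) 1, IsProbabilityMeasure (μ t))
    (hsupp : ∀ t ∈ Icc (0:ℝ) 1, μ t Mᶜ = 0)
    (hcont : WeakContOn μ (Icc 0 1))
    (hA : 0 < volume {t | t ∈ Icc (0:ℝ) 1 ∧ μ t ≪ volume})
    (μb₁ μb₂ : Measure (En n)) (h₁ : IsBarycenter μ μb₁) (h₂ : IsBarycenter μ μb₂) :
    μb₁ = μb₂ := by
  obtain ⟨R, hR⟩ := hM.exists_norm_le
  have hR' : ∀ t ∈ Icc (0 : ℝ) 1, ∀ᵐ x ∂(μ t), ‖x‖ ≤ R := fun t ht =>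
    Filter.mem_of_superset (compl_mem_ae_iff.2 (hsupp t ht)) fun x hx => hR x (by simpa using hx)
  have hmom : ∀ t ∈ Icc (0 : ℝ) 1, FinSecMom (μ t) := fun t ht => by
    have := hprob t ht
    refine Integrable.of_bound (by fun_prop) (R ^ 2) ((hR' t ht).mono fun x hx => ?_)
    rw [Real.norm_of_nonneg (sq_nonneg _)]
    exact pow_le_pow_left₀ (norm_nonneg x) hx 2
  obtain ⟨hp₁, hm₁, hmin₁⟩ := h₁
  obtain ⟨hp₂, hm₂, hmin₂⟩ := h₂
  have hpν := isProbabilityMeasure_mix μb₁ μb₂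
  have hmν := hm₁.mix hm₂
  set ν := (2⁻¹ : ℝ≥0∞) • μb₁ + (2⁻¹ : ℝ≥0∞) • μb₂
  have hi₁ := integrableOn_W2sq hprob hcont hR' hmom hm₁
  have hi₂ := integrableOn_W2sq hprob hcont hR' hmom hm₂
  have hiν := integrableOn_W2sq hprob hcont hR' hmom hmν
  let gap : ℝ → ℝ := fun t => (W2sq (μ t) μb₁ + W2sq (μ t) μb₂) / 2 - W2sq (μ t) ν
  have hgap_int : IntegrableOn gap (Icc 0 1) := ((hi₁.add hi₂).div_const 2).sub hiν
  have hgap_nonneg : 0 ≤ᵐ[volume.restrict (Icc 0 1)] gap := by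
    refine (ae_restrict_iff' measurableSet_Icc).2 (ae_of_all _ fun t ht => ?_)
    have := hprob t ht
    exact sub_nonneg.2 (W2sq_mix_le (hmom t ht) hm₁ hm₂)
  have hgap_le : ∫ t in Icc (0 : ℝ) 1, gap t ≤ 0 := by
    have : ∫ t in Icc (0 : ℝ) 1, gap t = ((∫ t in Icc (0 : ℝ) 1, W2sq (μ t) μb₁)
        + ∫ t in Icc (0 : ℝ) 1, W2sq (μ t) μb₂) / 2 - ∫ t in Icc (0 : ℝ) 1, W2sq (μ t) ν := by
      rw [← integral_add hi₁ hi₂, ← integral_div]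
      exact integral_sub ((hi₁.add hi₂).div_const 2) hiν
    have := hmin₁ ν hpν hmν
    have := hmin₂ ν hpν hmν
    linarith
  have hgap_zero := (integral_eq_zero_iff_of_nonneg_ae hgap_nonneg hgap_int).1
    (le_antisymm hgap_le (integral_nonneg_of_ae hgap_nonneg))
  have hgap_ae := (ae_restrict_iff' measurableSet_Icc).1 hgap_zero
  obtain ⟨t, ⟨ht, hac⟩, hgt⟩ : ∃ t ∈ {t | t ∈ Icc (0:ℝ) 1 ∧ μ t ≪ volume},
      t ∈ Icc (0 : ℝ) 1 → gap t = 0 := by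
    by_contra! hne
    refine hA.ne' (measure_mono_null (fun t ht => ?_) (ae_iff.1 hgap_ae))
    have := hne t ht
    simpa [and_assoc] using this
  have := hprob t ht
  exact eq_of_W2sq_mix_eq (hmom t ht) hm₁ hm₂ hac (sub_eq_zero.1 (hgt ht)).symm
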